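/- arXiv:2408.06770 — 2 statements merged into one kernel-verified Lean document; each statement's English description precedes it below -/
import Mathlib

section
/- A graph G has a path factor if and only if for every subset S of V(G), the number of isolated vertices of G − S is at most 2|S|. -/
open SimpleGraph

/-- A path cover (path factor) of `G`: pairwise vertex-disjoint paths, each on at
least two vertices, covering all vertices. -/
def SimpleGraph.IsPathCover {V : Type*} (G : SimpleGraph V)
    (F : Set (Σ u v : V, G.Walk u v)) : Prop :=
  (∀ p ∈ F, p.2.2.IsPath ∧ 1 ≤ p.2.2.length) ∧
  (∀ p ∈ F, ∀ q ∈ F, p ≠ q → ∀ x, x ∈ p.2.2.support → x ∉ q.2.2.support) ∧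
  (∀ v : V, ∃ p ∈ F, v ∈ p.2.2.support)

namespace SimpleGraph

/-- On a path, a vertex has at most two neighbours along the path. -/
lemma Walk.IsPath.mem_of_getVert_succ {V : Type*} {G : SimpleGraph V} {u v : V} {p : G.Walk u v}
    (hp : p.IsPath) {i j k : ℕ} (hi : i ≤ p.length) (hj : j ≤ p.length)
    (h : p.getVert i = p.getVert j) (hk : k + 1 = i ∨ k = i + 1) :
    p.getVert k = p.getVert (j - 1) ∨ p.getVert k = p.getVert (j + 1) := by
  obtain rfl : i = j := hp.getVert_injOn hi hj h
  rcases hk with rfl | rfl <;> simp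

/-- Every vertex of a path with at least one edge has a neighbour along the path. -/
lemma Walk.exists_getVert_neighbor {V : Type*} {G : SimpleGraph V} {u v x : V} {p : G.Walk u v}
    (hp : 1 ≤ p.length) (hx : x ∈ p.support) :
    ∃ i k, i ≤ p.length ∧ k ≤ p.length ∧ p.getVert k = x ∧ G.Adj x (p.getVert i) ∧
      (k + 1 = i ∨ k = i + 1) := by
  obtain ⟨k, rfl, hk⟩ := Walk.mem_support_iff_exists_getVert.1 hx
  rcases hk.lt_or_eq with h | h
  · exact ⟨k + 1, k, h, hk, rfl, p.adj_getVert_succ h, Or.inl rfl⟩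
  · refine ⟨k - 1, k, by omega, hk, rfl, ?_, Or.inr (by omega)⟩
    have := p.adj_getVert_succ (i := k - 1) (by omega)
    rw [Nat.sub_add_cancel (by omega)] at this
    exact this.symm

variable {V : Type*} [Fintype V]

lemma IsPathCover.ncard_isolated_le {G : SimpleGraph V} {F : Set (Σ u v : V, G.Walk u v)}
    (hF : G.IsPathCover F) (S : Finset V) :
    {v : V | v ∉ S ∧ ∀ w, G.Adj v w → w ∈ S}.ncard ≤ 2 * S.card := by
  classical
  obtain ⟨hpath, hdisj, hcov⟩ := hF
  choose P hPF hPmem using hcov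
  have hP : ∀ s v, s ∈ (P v).2.2.support → P s = P v := fun s v h => by
    by_contra hne
    exact hdisj _ (hPF s) _ (hPF v) hne s (hPmem s) h
  have key : ∀ v, ∃ s, G.Adj v s ∧ P s = P v ∧ ∃ i k, i ≤ (P v).2.2.length ∧
      (P v).2.2.getVert k = v ∧ (P v).2.2.getVert i = s ∧ (k + 1 = i ∨ k = i + 1) := by
    intro v
    obtain ⟨i, k, hi, -, hkv, hadj, hik⟩ :=
      Walk.exists_getVert_neighbor (hpath _ (hPF v)).2 (hPmem v)
    exact ⟨_, hadj, hP _ _ (Walk.getVert_mem_support _ _), i, k, hi, hkv, rfl, hik⟩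
  choose f hadj hPf hf using key
  rw [Set.ncard_eq_toFinset_card']
  refine Finset.card_le_mul_card_image_of_maps_to (f := f) (fun v hv => ?_) 2 fun s _ => ?_
  · simp only [Set.mem_toFinset, Set.mem_ofPred_eq] at hv
    exact hv.2 _ (hadj v)
  · obtain ⟨j, hjs, hj⟩ := Walk.mem_support_iff_exists_getVert.1 (hPmem s)
    refine (Finset.card_le_card (t := {(P s).2.2.getVert (j - 1), (P s).2.2.getVert (j + 1)})
      fun v hv => ?_).trans Finset.card_le_two
    obtain ⟨-, rfl⟩ := Finset.mem_filter.1 hv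
    obtain ⟨i, k, hi, hkv, his, hik⟩ := hf v
    rw [hPf v] at hjs hj ⊢
    have := (hpath _ (hPF v)).1.mem_of_getVert_succ hi hj (his.trans hjs.symm) hik
    rw [hkv] at this
    simpa using this

/-- Hall's theorem: under the isolated-vertex condition, each vertex can be assigned to a
neighbour so that no vertex is used more than twice. -/
lemma exists_adj_card_fiber_le_two [DecidableEq V] {G : SimpleGraph V}
    (h : ∀ S : Finset V, {v : V | v ∉ S ∧ ∀ w, G.Adj v w → w ∈ S}.ncard ≤ 2 * S.card) :
    ∃ f : V → V, (∀ v, G.Adj v (f v)) ∧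
      ∀ w, (Finset.univ.filter fun v => f v = w).card ≤ 2 := by
  classical
  have hall : ∀ X : Finset V,
      X.card ≤ (X.biUnion fun v => G.neighborFinset v ×ˢ (Finset.univ : Finset Bool)).card := by
    intro X
    rw [show (X.biUnion fun v => G.neighborFinset v ×ˢ (Finset.univ : Finset Bool)) =
      (X.biUnion fun v => G.neighborFinset v) ×ˢ Finset.univ by ext; simp, Finset.card_product, Finset.card_univ, Fintype.card_bool]
    set X₀ := X.filter fun v => ∀ w ∈ X, ¬ G.Adj v w
    set X₁ := X.filter fun v => ¬ ∀ w ∈ X, ¬ G.Adj v w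
    set N := X₀.biUnion fun v => G.neighborFinset v
    have hX : X₀.card + X₁.card = X.card := Finset.card_filter_add_card_filter_not _
    have hsub : X₁ ∪ N ⊆ X.biUnion fun v => G.neighborFinset v := by
      intro x hx
      simp only [X₀, X₁, N, Finset.mem_union, Finset.mem_filter, Finset.mem_biUnion,
        mem_neighborFinset] at hx ⊢
      rcases hx with ⟨-, hx⟩ | ⟨v, hv, hvx⟩
      · push Not at hx
        obtain ⟨w, hw, hxw⟩ := hx
        exact ⟨w, hw, hxw.symm⟩
      · exact ⟨v, hv.1, hvx⟩
    have hdis : Disjoint X₁ N := by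
      rw [Finset.disjoint_left]
      intro x hx hxN
      simp only [X₀, X₁, N, Finset.mem_filter, Finset.mem_biUnion, mem_neighborFinset] at hx hxN
      obtain ⟨v, hv, hvx⟩ := hxN
      exact hv.2 x hx.1 hvx
    have hcard := Finset.card_le_card hsub
    rw [Finset.card_union_of_disjoint hdis] at hcard
    have hN : X₀.card ≤ 2 * N.card := by
      refine le_trans ?_ (h N)
      rw [← Set.ncard_coe_finset]
      refine Set.ncard_le_ncard (fun v hv => ⟨fun hvN => ?_, fun w hw => ?_⟩) (Set.toFinite _)
      · obtain ⟨u, hu, huv⟩ := Finset.mem_biUnion.1 hvN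
        exact (Finset.mem_filter.1 hu).2 v (Finset.mem_filter.1 hv).1 (by simpa using huv)
      · exact Finset.mem_biUnion.2 ⟨v, hv, by simpa using hw⟩
    omega
  obtain ⟨g, hg, hgt⟩ := (Finset.all_card_le_biUnion_card_iff_exists_injective _).1 hall
  refine ⟨fun v => (g v).1, fun v => by simpa using hgt v, fun w => ?_⟩
  rw [← Fintype.card_bool, ← Finset.card_univ]
  refine Finset.card_le_card_of_injOn (fun v => (g v).2) (fun _ _ => by simp) fun a ha b hb hab => ?_
  simp only [Finset.coe_filter, Finset.mem_univ, true_and, Set.mem_ofPred_eq] at ha hb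
  exact hg (Prod.ext (ha.trans hb.symm) hab)

/-- Such an assignment with the most points of period two satisfies `f ∘ f ∘ f = f`. -/
lemma exists_adj_card_fiber_le_two_period [DecidableEq V] {G : SimpleGraph V}
    (h : ∃ f : V → V, (∀ v, G.Adj v (f v)) ∧
      ∀ w, (Finset.univ.filter fun v => f v = w).card ≤ 2) :
    ∃ f : V → V, (∀ v, G.Adj v (f v)) ∧
      (∀ w, (Finset.univ.filter fun v => f v = w).card ≤ 2) ∧ ∀ v, f (f (f v)) = f v := by
  classical
  obtain ⟨f, ⟨hadj, hfib⟩, hmax⟩ := Set.exists_max_image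
    {f : V → V | (∀ v, G.Adj v (f v)) ∧ ∀ w, (Finset.univ.filter fun v => f v = w).card ≤ 2}
    (fun f => (Finset.univ.filter fun v => f (f v) = v).card) (Set.toFinite _) h
  refine ⟨f, hadj, hfib, ?_⟩
  have hdeg : ∀ v, f (f (f v)) ≠ f v → 2 ≤ (Finset.univ.filter fun u => f u = v).card := by
    intro v hv
    by_contra! hlt
    have hne : v ≠ f v := (hadj v).ne
    set g := Function.update f (f v) v with hg
    have hgw : g (f v) = v := by simp [hg]
    have hgn : ∀ x, x ≠ f v → g x = f x := fun x hx => by simp [hg, hx]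
    have hgmem : g ∈ {f : V → V | (∀ v, G.Adj v (f v)) ∧
        ∀ w, (Finset.univ.filter fun v => f v = w).card ≤ 2} := by
      refine ⟨fun x => ?_, fun w => ?_⟩
      · by_cases hx : x = f v
        · rw [hx, hgw]; exact (hadj v).symm
        · rw [hgn x hx]; exact hadj x
      · by_cases hw : w = v
        · subst hw
          refine (Finset.card_le_card (t := insert (f w)
            (Finset.univ.filter fun u => f u = w)) fun x hx => ?_).trans
            ((Finset.card_insert_le _ _).trans (by omega))
          by_cases hxv : x = f w
          · simp [hxv]
          · simpa [hgn x hxv, hxv] using hx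
        · refine (Finset.card_le_card fun x hx => ?_).trans (hfib w)
          by_cases hxv : x = f v
          · simp only [hxv, Finset.mem_filter, hgw] at hx
            exact absurd hx.2.symm hw
          · simpa [hgn x hxv] using hx
    have hlt' : (Finset.univ.filter fun v => f (f v) = v).card <
        (Finset.univ.filter fun v => g (g v) = v).card := by
      refine Finset.card_lt_card ((Finset.ssubset_iff_of_subset fun x hx => ?_).2
        ⟨f v, ?_, ?_⟩)
      · simp only [Finset.mem_filter, Finset.mem_univ, true_and] at hx ⊢
        have h1 : x ≠ f v := by rintro rfl; exact hv hx
        have h2 : f x ≠ f v := by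
          intro h2
          rw [← h2, hx] at hv
          exact hv rfl
        rw [hgn x h1, hgn _ h2, hx]
      · simp [hgw, hgn v hne]
      · simpa using hv
    exact absurd (hmax g hgmem) (not_le.2 hlt')
  set B := Finset.univ.filter fun v => f (f (f v)) ≠ f v with hB
  have hBcard : B.card * 2 ≤ (B.filter fun u => f u ∈ B).card := by
    rw [Finset.card_eq_sum_card_fiberwise (s := B.filter fun u => f u ∈ B)
      (f := f) (t := B) (fun u hu => (Finset.mem_filter.1 hu).2), ← smul_eq_mul, ← Finset.sum_const]
    refine Finset.sum_le_sum fun v hv => ?_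
    have hv' := (Finset.mem_filter.1 hv).2
    refine (hdeg v hv').trans (Finset.card_le_card fun u hu => ?_)
    obtain rfl := (Finset.mem_filter.1 hu).2
    simp only [Finset.mem_filter, hv, and_true]
    refine Finset.mem_filter.2 ⟨Finset.mem_univ _, fun h => hv' (congrArg f h)⟩
  have hB0 : B = ∅ := by
    have := Finset.card_filter_le B fun u => f u ∈ B
    exact Finset.card_eq_zero.1 (by omega)
  intro v
  by_contra hv
  have : v ∈ B := Finset.mem_filter.2 ⟨Finset.mem_univ _, hv⟩
  simp [hB0] at this

/-- A fibre with at most two elements, one of them known. -/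
lemma exists_forall_eq_or_eq_of_card_fiber_le_two [DecidableEq V] {f : V → V} {a b : V}
    (hfib : (Finset.univ.filter fun v => f v = a).card ≤ 2) (hb : f b = a) :
    ∃ x, f x = a ∧ ∀ z, f z = a → z = b ∨ z = x := by
  by_cases h : ∃ x, f x = a ∧ x ≠ b
  · obtain ⟨x, hx, hxb⟩ := h
    refine ⟨x, hx, fun z hz => ?_⟩
    by_contra! hne
    have : ({b, x, z} : Finset V).card ≤ 2 :=
      (Finset.card_le_card fun y hy => by
        simp only [Finset.mem_insert, Finset.mem_singleton] at hy
        rcases hy with rfl | rfl | rfl <;> simp [*]).trans hfib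
    rw [Finset.card_eq_three.2 ⟨b, x, z, hxb.symm, hne.1.symm, hne.2.symm, rfl⟩] at this
    omega
  · push Not at h
    exact ⟨b, hb, fun z hz => Or.inl (h z hz)⟩

lemma exists_isPath_support_eq_fibers [DecidableEq V] {G : SimpleGraph V} {f : V → V}
    (hadj : ∀ v, G.Adj v (f v)) (hfib : ∀ w, (Finset.univ.filter fun v => f v = w).card ≤ 2)
    {a b : V} (hab : f a = b) (hba : f b = a) :
    ∃ p : Σ u v : V, G.Walk u v, (p.2.2.IsPath ∧ 1 ≤ p.2.2.length) ∧
      ∀ z, z ∈ p.2.2.support ↔ f z = a ∨ f z = b := by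
  obtain ⟨x, hx, hx'⟩ := exists_forall_eq_or_eq_of_card_fiber_le_two (hfib a) hba
  obtain ⟨y, hy, hy'⟩ := exists_forall_eq_or_eq_of_card_fiber_le_two (hfib b) hab
  have adj : G.Adj a b := hab ▸ hadj a
  have adjx : G.Adj x a := hx ▸ hadj x
  have adjy : G.Adj b y := hy ▸ (hadj y).symm
  have hne : a ≠ b := adj.ne
  have hxa : x ≠ a := adjx.ne
  have hby : b ≠ y := adjy.ne
  have hxy : x ≠ y := by rintro rfl; exact hne (hx.symm.trans hy)
  by_cases hxb : x = b <;> by_cases hya : y = a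
  · refine ⟨⟨a, b, .cons adj .nil⟩, ?_, fun z => ?_⟩
    · simp [Walk.isPath_def, hne]
    · simp; grind
  · refine ⟨⟨a, y, .cons adj (.cons adjy .nil)⟩, ?_, fun z => ?_⟩
    · simp [Walk.isPath_def]; grind
    · simp; grind
  · refine ⟨⟨x, b, .cons adjx (.cons adj .nil)⟩, ?_, fun z => ?_⟩
    · simp [Walk.isPath_def]; grind
    · simp; grind
  · refine ⟨⟨x, y, .cons adjx (.cons adj (.cons adjy .nil))⟩, ?_, fun z => ?_⟩
    · simp [Walk.isPath_def]; grind
    · simp; grind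

lemma exists_isPathCover_of_period [DecidableEq V] {G : SimpleGraph V} {f : V → V}
    (hadj : ∀ v, G.Adj v (f v)) (hfib : ∀ w, (Finset.univ.filter fun v => f v = w).card ≤ 2)
    (hper : ∀ v, f (f (f v)) = f v) :
    ∃ F : Set (Σ u v : V, G.Walk u v), G.IsPathCover F := by
  let K : V → Set V := fun v => {z | f z = f v ∨ f z = f (f v)}
  have hK : ∀ z v, z ∈ K v → K z = K v := by
    rintro z v (h | h)
    · simp only [K, h]
    · ext y
      simp only [K, h, hper, Set.mem_ofPred_eq, or_comm]
  have hpath : ∀ C : Set.range K, ∃ p : Σ u v : V, G.Walk u v,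
      (p.2.2.IsPath ∧ 1 ≤ p.2.2.length) ∧ ∀ z, z ∈ p.2.2.support ↔ z ∈ C.1 := by
    rintro ⟨_, v, rfl⟩
    exact exists_isPath_support_eq_fibers hadj hfib rfl (hper v)
  choose g hg hgs using hpath
  refine ⟨Set.range g, ?_, ?_, fun v => ⟨_, ⟨⟨K v, v, rfl⟩, rfl⟩, (hgs _ v).2 (Or.inl rfl)⟩⟩
  · rintro _ ⟨C, rfl⟩
    exact hg C
  · rintro _ ⟨⟨_, v, rfl⟩, rfl⟩ _ ⟨⟨_, w, rfl⟩, rfl⟩ hne x hx hx'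
    rw [hgs] at hx hx'
    exact hne (congrArg g (Subtype.ext ((hK x v hx).symm.trans (hK x w hx'))))

end SimpleGraph

/-- A graph `G` has a path factor iff for every `S ⊆ V(G)`, the number of isolated
vertices of `G − S` is at most `2|S|`. -/
theorem stmt2 {V : Type*} [Fintype V] (G : SimpleGraph V) :
    (∃ F : Set (Σ u v : V, G.Walk u v), G.IsPathCover F) ↔
    ∀ S : Finset V,
      {v : V | v ∉ S ∧ ∀ w, G.Adj v w → w ∈ S}.ncard ≤ 2 * S.card := by
  classical
  refine ⟨fun ⟨_, hF⟩ => hF.ncard_isolated_le, fun h => ?_⟩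
  obtain ⟨f, hadj, hfib, hper⟩ :=
    exists_adj_card_fiber_le_two_period (exists_adj_card_fiber_le_two h)
  exact exists_isPathCover_of_period hadj hfib hper
end

section
/- For every integer Δ ≥ 3, there exists a tree T of maximum degree Δ that has a path factor, such that for every m ≤ 4Δ − 3, the Cartesian product T □ Pₘ is not hamiltonian. -/
open SimpleGraph

namespace SimpleGraph

section Transport

variable {α β : Type*} {G : SimpleGraph α} {G' : SimpleGraph β}

lemma Iso.ncard_neighborSet_eq (e : G ≃g G') (v : α) :
    (G'.neighborSet (e v)).ncard = (G.neighborSet v).ncard :=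
  (Set.ncard_congr' (e.mapNeighborSet v)).symm

lemma IsHamiltonian.of_iso [Fintype α] [Fintype β] [DecidableEq α] [DecidableEq β]
    (e : G ≃g G') (h : G.IsHamiltonian) : G'.IsHamiltonian := by
  intro hβ
  obtain ⟨a, p, hp⟩ := h (by rwa [Fintype.card_congr e.toEquiv])
  exact ⟨_, p.map e.toHom, Walk.IsHamiltonianCycle.map (f := e.toHom) e.bijective hp⟩

/-- The isomorphism of Cartesian products induced by an isomorphism of the left factors. -/
def Iso.boxProdCongrLeft {γ : Type*} (e : G ≃g G') (K : SimpleGraph γ) :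
    boxProd G K ≃g boxProd G' K where
  toEquiv := e.toEquiv.prodCongr (Equiv.refl γ)
  map_rel_iff' := by
    rintro ⟨a, b⟩ ⟨c, d⟩
    simp [boxProd_adj, e.map_adj_iff]

lemma IsPathCover.exists_of_iso (e : G ≃g G') {F : Set (Σ u v : α, G.Walk u v)}
    (hF : G.IsPathCover F) : ∃ F' : Set (Σ u v : β, G'.Walk u v), G'.IsPathCover F' := by
  obtain ⟨hpath, hdisj, hcover⟩ := hF
  refine ⟨(fun p ↦ ⟨_, _, p.2.2.map e.toHom⟩) '' F, ?_, ?_, fun v ↦ ?_⟩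
  · rintro _ ⟨p, hp, rfl⟩
    exact ⟨(hpath p hp).1.map e.injective, by simpa using (hpath p hp).2⟩
  · rintro _ ⟨p, hp, rfl⟩ _ ⟨q, hq, rfl⟩ hpq x hx hx'
    simp only [Walk.support_map, List.mem_map] at hx hx'
    obtain ⟨y, hy, rfl⟩ := hx
    obtain ⟨z, hz, hzy⟩ := hx'
    obtain rfl : z = y := e.injective hzy
    exact hdisj p hp q hq (by rintro rfl; exact hpq rfl) z hy hz
  · obtain ⟨p, hp, hv⟩ := hcover (e.symm v)
    refine ⟨_, ⟨p, hp, rfl⟩, ?_⟩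
    simp only [Walk.support_map, List.mem_map]
    exact ⟨_, hv, e.apply_symm_apply v⟩

end Transport

/-- A hamiltonian graph has a connected 2-regular spanning subgraph. -/
lemma IsHamiltonian.exists_connected_two_regular {α : Type*} [Fintype α] [DecidableEq α]
    [Nontrivial α] {G : SimpleGraph α} (h : G.IsHamiltonian) :
    ∃ H ≤ G, H.Connected ∧ ∀ v, (H.neighborSet v).ncard = 2 := by
  obtain ⟨a, p, hp⟩ := h Fintype.one_lt_card.ne'
  have hspan : p.toSubgraph.IsSpanning := fun v ↦ p.mem_verts_toSubgraph.2 (hp.mem_support v)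
  refine ⟨p.toSubgraph.spanningCoe, p.toSubgraph.spanningCoe_le, ?_, fun v ↦ ?_⟩
  · rw [(p.toSubgraph.spanningCoeEquivCoeOfSpanning hspan).connected_iff]
    exact p.toSubgraph_connected.coe
  · exact hp.isCycle.ncard_neighborSet_toSubgraph_eq_two (hp.mem_support v)

section Layers

variable {V : Type*} {m : ℕ} (H : SimpleGraph (V × Fin m))

open Classical in
/-- Indicator of the edge of `H` joining columns `k` and `k + 1` in row `x`. -/
noncomputable def rowEdge (x : V) (k : ℕ) : ℤ :=
  if ∃ h : k + 1 < m, H.Adj (x, ⟨k, by omega⟩) (x, ⟨k + 1, h⟩) then 1 else 0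

open Classical in
/-- Indicator of the edge of `H` joining rows `x` and `y` in column `k`. -/
noncomputable def columnEdge (x y : V) (k : ℕ) : ℤ :=
  if ∃ h : k < m, H.Adj (x, ⟨k, h⟩) (y, ⟨k, h⟩) then 1 else 0

/-- Alternating sum of the indicators of the edges between rows `x` and `y` up to column `k`. -/
noncomputable def alternatingEdgeSum (x y : V) (k : ℕ) : ℤ :=
  ∑ j ∈ Finset.range (k + 1), (-1) ^ j * columnEdge H x y j

lemma columnEdge_comm (x y : V) (k : ℕ) : columnEdge H x y k = columnEdge H y x k := by
  classical
  exact if_congr (exists_congr fun _ ↦ H.adj_comm _ _) rfl rfl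

lemma alternatingEdgeSum_comm (x y : V) (k : ℕ) :
    alternatingEdgeSum H x y k = alternatingEdgeSum H y x k := by
  simp only [alternatingEdgeSum, columnEdge_comm H x y]

lemma alternatingEdgeSum_zero (x y : V) : alternatingEdgeSum H x y 0 = columnEdge H x y 0 := by
  simp [alternatingEdgeSum]

lemma alternatingEdgeSum_succ (x y : V) (k : ℕ) : alternatingEdgeSum H x y (k + 1) =
    alternatingEdgeSum H x y k + (-1) ^ (k + 1) * columnEdge H x y (k + 1) := by
  rw [alternatingEdgeSum, Finset.sum_range_succ, alternatingEdgeSum]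

lemma rowEdge_nonneg (x : V) (k : ℕ) : 0 ≤ rowEdge H x k := by
  unfold rowEdge; split_ifs <;> simp

lemma rowEdge_le_one (x : V) (k : ℕ) : rowEdge H x k ≤ 1 := by
  unfold rowEdge; split_ifs <;> simp

lemma columnEdge_nonneg (x y : V) (k : ℕ) : 0 ≤ columnEdge H x y k := by
  unfold columnEdge; split_ifs <;> simp

lemma rowEdge_last (x : V) : rowEdge H x (m - 1) = 0 := by
  unfold rowEdge
  rw [if_neg]
  rintro ⟨h, -⟩
  omega

variable {H}
variable [Fintype V] {G : SimpleGraph V} [DecidableRel G.Adj]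

lemma sum_columnEdge_add_rowEdge (hH : H ≤ G □ pathGraph m)
    (hdeg : ∀ v, (H.neighborSet v).ncard = 2) (x : V) {k : ℕ} (hk : k < m) :
    ∑ y ∈ G.neighborFinset x, columnEdge H x y k +
      (if k = 0 then 0 else rowEdge H x (k - 1)) + rowEdge H x k = 2 := by
  classical
  have hcard : ∑ q ∈ (G □ pathGraph m).neighborFinset (x, ⟨k, hk⟩),
      (if H.Adj (x, ⟨k, hk⟩) q then (1 : ℤ) else 0) = 2 := by
    rw [Finset.sum_boole]
    have := hdeg (x, ⟨k, hk⟩)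
    rw [Set.ncard_eq_toFinset_card'] at this
    rw [← Nat.cast_two, ← this]
    congr 2
    ext q
    simp only [Finset.mem_filter, mem_neighborFinset, Set.mem_toFinset, mem_neighborSet]
    exact ⟨And.right, fun h ↦ ⟨hH h, h⟩⟩
  have hrow : ∑ l ∈ (pathGraph m).neighborFinset ⟨k, hk⟩,
      (if H.Adj (x, ⟨k, hk⟩) (x, l) then (1 : ℤ) else 0) =
      (if k = 0 then 0 else rowEdge H x (k - 1)) + rowEdge H x k := by
    set g : Fin m → ℤ := fun l ↦ if H.Adj (x, ⟨k, hk⟩) (x, l) then 1 else 0 with hg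
    have hsplit : ∀ l ∈ (pathGraph m).neighborFinset ⟨k, hk⟩,
        g l = (if l.val + 1 = k then g l else 0) + (if l.val = k + 1 then g l else 0) := by
      intro l hl
      rw [mem_neighborFinset, pathGraph_adj] at hl
      split_ifs <;> simp_all
      omega
    rw [Finset.sum_congr rfl hsplit, Finset.sum_add_distrib]
    congr 1
    · split_ifs with h0
      · exact Finset.sum_eq_zero fun l _ ↦ if_neg (by omega)
      · rw [Finset.sum_eq_single ⟨k - 1, by omega⟩]
        · have h1 : k - 1 + 1 = k := by omega
          simp [hg, rowEdge, h1, hk, H.adj_comm (x, ⟨k, hk⟩)]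
        · exact fun l _ hl ↦ if_neg fun h ↦ hl (Fin.ext (by simp; omega))
        · exact fun h ↦ absurd (by simp [pathGraph_adj]; omega) h
    · by_cases h1 : k + 1 < m
      · rw [Finset.sum_eq_single ⟨k + 1, h1⟩]
        · simp [hg, rowEdge, h1]
        · exact fun l _ hl ↦ if_neg fun h ↦ hl (Fin.ext h)
        · exact fun h ↦ absurd (by simp [pathGraph_adj]) h
      · rw [rowEdge, if_neg (fun h ↦ h1 h.1)]
        exact Finset.sum_eq_zero fun l _ ↦ if_neg (by omega)
  rw [neighborFinset_boxProd, Finset.sum_disjUnion, Finset.sum_product, Finset.sum_product] at hcard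
  simp only [Finset.sum_singleton] at hcard
  rw [hrow] at hcard
  rw [add_assoc, ← hcard]
  congr 1
  refine Finset.sum_congr rfl fun y _ ↦ ?_
  simp [columnEdge, hk]

lemma sum_alternatingEdgeSum (hH : H ≤ G □ pathGraph m)
    (hdeg : ∀ v, (H.neighborSet v).ncard = 2) (x : V) {k : ℕ} (hk : k < m) :
    ∑ y ∈ G.neighborFinset x, alternatingEdgeSum H x y k =
      (if Even k then 2 else 0) - (-1) ^ k * rowEdge H x k := by
  induction k with
  | zero =>
    have := sum_columnEdge_add_rowEdge hH hdeg x hk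
    simp only [alternatingEdgeSum_zero, if_true] at this ⊢
    simp
    linarith
  | succ k ih =>
    have h := sum_columnEdge_add_rowEdge hH hdeg x hk
    simp only [Nat.add_eq_zero_iff, one_ne_zero, and_false, if_false, Nat.add_sub_cancel] at h
    simp only [alternatingEdgeSum_succ, Finset.sum_add_distrib, ← Finset.mul_sum]
    rw [ih (by omega)]
    rcases Nat.even_or_odd k with hk' | hk'
    · simp only [hk', Nat.even_add_one, pow_succ, hk'.neg_one_pow, not_true, if_true, if_false]
      linarith
    · simp only [Nat.not_even_iff_odd.2 hk', Nat.even_add_one, pow_succ, hk'.neg_one_pow,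
        not_false_iff, if_true, if_false]
      linarith

end Layers

end SimpleGraph

/-- Vertices of the double broom: a root with two hubs, each hub having `n` further neighbours,
the centers, each of which carries two leaves. -/
inductive BroomVertex (n : ℕ)
  | root
  | hub (s : Bool)
  | center (s : Bool) (i : Fin n)
  | leaf (s : Bool) (i : Fin n) (t : Bool)
  deriving DecidableEq, Fintype

namespace BroomVertex

variable {n : ℕ}

/-- The parent of a vertex, the root being its own parent. -/
def parent : BroomVertex n → BroomVertex n
  | root => root
  | hub _ => root
  | center s _ => hub s
  | leaf s i _ => center s i

/-- The tree in which every vertex other than the root is joined to its parent. -/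
def tree (n : ℕ) : SimpleGraph (BroomVertex n) :=
  SimpleGraph.fromRel fun x y ↦ x.parent = y

instance : DecidableRel (tree n).Adj :=
  inferInstanceAs (DecidableRel (SimpleGraph.fromRel _).Adj)

lemma tree_adj {x y : BroomVertex n} :
    (tree n).Adj x y ↔ x ≠ y ∧ (x.parent = y ∨ y.parent = x) := Iff.rfl

lemma tree_isTree : (tree n).IsTree := by
  have hroot : ∀ x, (tree n).Reachable x root := by
    have h1 : ∀ s, (tree n).Reachable (hub s) root := fun s ↦
      Adj.reachable (by simp [tree_adj, parent])
    have h2 : ∀ s i, (tree n).Reachable (center s i) root := fun s i ↦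
      (Adj.reachable (by simp [tree_adj, parent])).trans (h1 s)
    have h3 : ∀ s i t, (tree n).Reachable (leaf s i t) root := fun s i t ↦
      (Adj.reachable (by simp [tree_adj, parent])).trans (h2 s i)
    rintro (_ | s | ⟨s, i⟩ | ⟨s, i, t⟩)
    exacts [.refl _, h1 s, h2 s i, h3 s i t]
  have hconn : (tree n).Connected :=
    { preconnected := fun x y ↦ (hroot x).trans (hroot y).symm
      nonempty := ⟨root⟩ }
  refine isTree_iff_connected_and_card.2 ⟨hconn, le_antisymm ?_ ?_⟩
  · have hsub : (tree n).edgeSet ⊆ (fun x ↦ s(x, x.parent)) '' ({root}ᶜ : Set (BroomVertex n)) := by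
      rintro ⟨x, y⟩ h
      obtain ⟨hne, h | h⟩ := tree_adj.1 ((tree n).mem_edgeSet.1 h)
      · exact ⟨x, fun hx ↦ hne (by rw [← h, hx]; rfl), congrArg (s(x, ·)) h⟩
      · exact ⟨y, fun hy ↦ hne (by rw [← h, hy]; rfl), (congrArg (s(y, ·)) h).trans Sym2.eq_swap⟩
    have h1 := (Set.ncard_le_ncard hsub).trans (Set.ncard_image_le (Set.toFinite _))
    have h2 := Set.ncard_add_ncard_compl ({root} : Set (BroomVertex n))
    rw [Set.ncard_singleton] at h2
    rw [Nat.card_coe_set_eq]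
    omega
  · exact hconn.card_vert_le_card_edgeSet_add_one

lemma neighborFinset_root :
    (tree n).neighborFinset root = {hub false, hub true} := by
  ext (_ | s | ⟨s, i⟩ | ⟨s, i, t⟩) <;> simp [tree_adj, parent]

lemma neighborFinset_hub (s : Bool) : (tree n).neighborFinset (hub s) =
    insert root (Finset.univ.image (center s)) := by
  ext (_ | s' | ⟨s', i⟩ | ⟨s', i, t⟩) <;> simp [tree_adj, parent, eq_comm]

lemma neighborFinset_center (s : Bool) (i : Fin n) : (tree n).neighborFinset (center s i) =
    {hub s, leaf s i false, leaf s i true} := by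
  ext (_ | s' | ⟨s', i'⟩ | ⟨s', i', t⟩)
  · simp [tree_adj, parent]
  · simp [tree_adj, parent, eq_comm]
  · simp [tree_adj, parent]
  · cases t <;> simp [tree_adj, parent]

lemma neighborFinset_leaf (s : Bool) (i : Fin n) (t : Bool) :
    (tree n).neighborFinset (leaf s i t) = {center s i} := by
  ext (_ | s' | ⟨s', i'⟩ | ⟨s', i', t⟩) <;> simp [tree_adj, parent, eq_comm]

lemma sum_neighborFinset_hub (s : Bool) (f : BroomVertex n → ℤ) :
    ∑ y ∈ (tree n).neighborFinset (hub s), f y = f root + ∑ i, f (center s i) := by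
  rw [neighborFinset_hub, Finset.sum_insert (by simp), Finset.sum_image]
  exact fun i _ j _ h ↦ by simpa using h

lemma degree_hub (s : Bool) : (tree n).degree (hub s) = n + 1 := by
  rw [degree, neighborFinset_hub, Finset.card_insert_of_notMem (by simp),
    Finset.card_image_of_injective _ (fun i j h ↦ by simpa using h), Finset.card_univ,
    Fintype.card_fin]

lemma degree_le (hn : 2 ≤ n) (x : BroomVertex n) : (tree n).degree x ≤ n + 1 := by
  rcases x with _ | s | ⟨s, i⟩ | ⟨s, i, t⟩
  · rw [degree, neighborFinset_root]
    exact Finset.card_le_two.trans (by omega)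
  · exact (degree_hub s).le
  · rw [degree, neighborFinset_center]
    exact Finset.card_le_three.trans (by omega)
  · rw [degree, neighborFinset_leaf, Finset.card_singleton]
    omega

lemma exists_isPathCover (n : ℕ) :
    ∃ F : Set (Σ u v : BroomVertex n, (tree n).Walk u v), (tree n).IsPathCover F := by
  have hr : ∀ s, (tree n).Adj (hub s) root := by simp [tree_adj, parent]
  have hl : ∀ s i t, (tree n).Adj (leaf s i t) (center s i) := by simp [tree_adj, parent]
  let path : Option (Bool × Fin n) → Σ u v : BroomVertex n, (tree n).Walk u v := fun
    | none => ⟨_, _, .cons (hr false) (.cons (hr true).symm .nil)⟩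
    | some (s, i) => ⟨_, _, .cons (hl s i false) (.cons (hl s i true).symm .nil)⟩
  let block : BroomVertex n → Option (Bool × Fin n) := fun
    | root => none
    | hub _ => none
    | center s i => some (s, i)
    | leaf s i _ => some (s, i)
  have hblock : ∀ j x, x ∈ (path j).2.2.support ↔ block x = j := by
    rintro (_ | ⟨s, i⟩) (_ | s' | ⟨s', i'⟩ | ⟨s', i', t⟩)
    all_goals simp [path, block]
    · cases t <;> simp
  refine ⟨Set.range path, ?_, ?_, fun x ↦ ⟨_, ⟨block x, rfl⟩, (hblock _ _).2 rfl⟩⟩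
  · rintro _ ⟨_ | ⟨s, i⟩, rfl⟩ <;> simp [path]
  · rintro _ ⟨j, rfl⟩ _ ⟨j', rfl⟩ hne x hx hx'
    rw [hblock] at hx hx'
    exact hne (by rw [← hx, ← hx'])

section Hamiltonian

variable {m : ℕ} {H : SimpleGraph (BroomVertex n × Fin m)}

/-- In even columns (counted from `0`), all hubs continue to the next column, the root does not,
and the edges between a center and its hub balance. -/
lemma alternation (hH : H ≤ tree n □ pathGraph m) (hdeg : ∀ v, (H.neighborSet v).ncard = 2)
    {k : ℕ} (hk : k < m) (hke : Even k) :
    (∀ s, rowEdge H (hub s) k = 1) ∧ rowEdge H root k = 0 ∧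
      ∀ s i, alternatingEdgeSum H (hub s) (center s i) k = 0 := by
  have key := fun x ↦ sum_alternatingEdgeSum hH hdeg x hk
  simp only [hke, if_true, hke.neg_one_pow, one_mul] at key
  have hroot := key root
  rw [neighborFinset_root, Finset.sum_pair (by simp)] at hroot
  have hhub := fun s ↦ key (hub s)
  simp only [sum_neighborFinset_hub, alternatingEdgeSum_comm H _ root] at hhub
  have hcenter : ∀ s i, alternatingEdgeSum H (hub s) (center s i) k ≤ 0 := by
    intro s i
    have hc := key (center s i)
    have hl := fun t ↦ key (leaf s i t)
    simp only [neighborFinset_leaf, Finset.sum_singleton] at hl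
    rw [neighborFinset_center, Finset.sum_insert (by simp), Finset.sum_pair (by simp),
      alternatingEdgeSum_comm H _ (hub s), alternatingEdgeSum_comm H _ (leaf s i false),
      alternatingEdgeSum_comm H _ (leaf s i true), hl, hl] at hc
    linarith [rowEdge_le_one H (leaf s i false) k, rowEdge_le_one H (leaf s i true) k,
      rowEdge_nonneg H (center s i) k]
  have hsum := fun s ↦ Finset.sum_nonpos fun i (_ : i ∈ Finset.univ) ↦ hcenter s i
  have hf := hhub false
  have ht := hhub true
  have hle := fun s ↦ rowEdge_le_one H (hub s) k
  have hnonneg := rowEdge_nonneg H root k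
  have hsum_zero : ∀ s, ∑ i, alternatingEdgeSum H (hub s) (center s i) k = 0 := by
    rintro (_ | _) <;> linarith [hsum false, hsum true, hle false, hle true]
  refine ⟨?_, ?_, fun s i ↦ ?_⟩
  · rintro (_ | _) <;> linarith [hsum false, hsum true, hle false, hle true]
  · linarith [hsum false, hsum true, hle false, hle true]
  · exact (Finset.sum_eq_zero_iff_of_nonpos fun i _ ↦ hcenter s i).1 (hsum_zero s) i
      (Finset.mem_univ i)

lemma even_length (hH : H ≤ tree n □ pathGraph m) (hdeg : ∀ v, (H.neighborSet v).ncard = 2)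
    (hm : 1 ≤ m) : Even m := by
  by_contra hodd
  have hlast : Even (m - 1) := by
    rw [Nat.even_iff] at hodd ⊢
    omega
  have := (alternation hH hdeg (by omega) hlast).1 false
  rw [rowEdge_last] at this
  exact zero_ne_one this

lemma alternatingEdgeSum_last (hH : H ≤ tree n □ pathGraph m)
    (hdeg : ∀ v, (H.neighborSet v).ncard = 2) (hm : 1 ≤ m) (s : Bool) (i : Fin n) :
    alternatingEdgeSum H (hub s) (center s i) (m - 1) = 0 := by
  have hlast : ¬ Even (m - 1) := by
    obtain ⟨r, rfl⟩ := even_length hH hdeg hm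
    rw [Nat.even_iff]
    omega
  have key := fun x ↦ sum_alternatingEdgeSum hH hdeg x (k := m - 1) (by omega)
  simp only [hlast, if_false, rowEdge_last, mul_zero, sub_zero] at key
  have hc := key (center s i)
  have hl := fun t ↦ key (leaf s i t)
  simp only [neighborFinset_leaf, Finset.sum_singleton] at hl
  rw [neighborFinset_center, Finset.sum_insert (by simp), Finset.sum_pair (by simp),
    alternatingEdgeSum_comm H _ (hub s), alternatingEdgeSum_comm H _ (leaf s i false),
    alternatingEdgeSum_comm H _ (leaf s i true), hl, hl] at hc
  linarith

/-- The rows of a center and its leaves are joined to the rest of a connected `H`. -/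
lemma exists_columnEdge_hub_center (hH : H ≤ tree n □ pathGraph m) (hconn : H.Connected)
    (hm : 1 ≤ m) (s : Bool) (i : Fin n) :
    ∃ k < m, columnEdge H (hub s) (center s i) k = 1 := by
  let S : Set (BroomVertex n × Fin m) := {p | p.1 = center s i ∨ p.1.parent = center s i}
  obtain ⟨w⟩ := hconn.preconnected (center s i, ⟨0, hm⟩) (root, ⟨0, hm⟩)
  obtain ⟨⟨⟨⟨x, k⟩, ⟨y, l⟩⟩, hadj⟩, -, hx, hy⟩ :=
    w.exists_boundary_dart S (Or.inl rfl) (by simp [S, parent])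
  have hxy := boxProd_adj.1 (hH hadj)
  simp only [S, Set.mem_ofPred_eq, not_or] at hx hy hxy hadj
  rcases hxy with ⟨ht, rfl⟩ | ⟨-, rfl⟩
  · rcases hx with rfl | hx
    · obtain ⟨-, h | h⟩ := tree_adj.1 ht
      · subst h
        exact ⟨k, k.2, by simp [columnEdge, parent] at hadj ⊢; exact hadj.symm⟩
      · exact absurd h hy.2
    · obtain ⟨-, h | h⟩ := tree_adj.1 ht
      · exact absurd (h.symm.trans hx) hy.1
      · rcases y with _ | s' | ⟨s', i'⟩ | ⟨s', i', t⟩ <;> subst h <;> simp [parent] at hx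
  · tauto

/-- Every center is joined to its hub in some odd column other than the last one. -/
lemma exists_odd_columnEdge (hH : H ≤ tree n □ pathGraph m)
    (hdeg : ∀ v, (H.neighborSet v).ncard = 2) (hconn : H.Connected) (hm : 1 ≤ m)
    (s : Bool) (i : Fin n) :
    ∃ j, 2 * j + 4 ≤ m ∧ columnEdge H (hub s) (center s i) (2 * j + 1) = 1 := by
  by_contra! hno
  have hzero : ∀ k, columnEdge H (hub s) (center s i) k ≠ 1 →
      columnEdge H (hub s) (center s i) k = 0 := by
    intro k
    unfold columnEdge
    split_ifs <;> simp
  have halt : ∀ k < m, Even k → alternatingEdgeSum H (hub s) (center s i) k = 0 :=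
    fun k hk hke ↦ (alternation hH hdeg hk hke).2.2 s i
  have hmeven := even_length hH hdeg hm
  obtain ⟨k, hk, hone⟩ := exists_columnEdge_hub_center hH hconn hm s i
  obtain ⟨j, rfl | rfl⟩ := k.even_or_odd'
  · obtain _ | j := j
    · have := halt 0 hk Even.zero
      rw [alternatingEdgeSum_zero] at this
      simp_all
    · have h1 := halt (2 * j) (by omega) (even_two_mul j)
      have h2 := halt (2 * (j + 1)) hk (even_two_mul _)
      change columnEdge H (hub s) (center s i) (2 * j + 1 + 1) = 1 at hone
      rw [mul_add, mul_one, alternatingEdgeSum_succ, alternatingEdgeSum_succ, h1,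
        hzero _ (hno j (by rcases hmeven with ⟨r, rfl⟩; omega)), hone] at h2
      simp at h2
  · have hj : 2 * j + 1 = m - 1 := by
      by_contra hne
      exact hno j (by rcases hmeven with ⟨r, rfl⟩; omega) hone
    have h1 := halt (2 * j) (by omega) (even_two_mul j)
    have h2 := alternatingEdgeSum_last hH hdeg hm s i
    rw [← hj, alternatingEdgeSum_succ, h1, hone] at h2
    simp at h2

lemma not_columnEdge_of_ne (hH : H ≤ tree n □ pathGraph m)
    (hdeg : ∀ v, (H.neighborSet v).ncard = 2) {j : ℕ} (hj : 2 * j + 1 < m)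
    {s s' : Bool} {i i' : Fin n} (hne : (s, i) ≠ (s', i'))
    (h : columnEdge H (hub s) (center s i) (2 * j + 1) = 1) :
    columnEdge H (hub s') (center s' i') (2 * j + 1) ≠ 1 := by
  intro h'
  obtain ⟨hhub, hroot, -⟩ := alternation hH hdeg (k := 2 * j) (by omega) (even_two_mul j)
  have hdegree := fun x ↦ sum_columnEdge_add_rowEdge hH hdeg x hj
  simp only [Nat.add_eq_zero_iff, one_ne_zero, and_false, if_false, Nat.add_sub_cancel] at hdegree
  have hhub_degree := fun s ↦ hdegree (hub s)
  simp only [sum_neighborFinset_hub, hhub] at hhub_degree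
  by_cases hs : s = s'
  · subst hs
    have hi : i ≠ i' := fun hi ↦ hne (by rw [hi])
    have hsum := Finset.sum_le_univ_sum_of_nonneg (s := {i, i'})
      (fun l ↦ columnEdge_nonneg H (hub s) (center s l) (2 * j + 1))
    rw [Finset.sum_pair hi, h, h'] at hsum
    linarith [hhub_degree s, columnEdge_nonneg H (hub s) root (2 * j + 1),
      rowEdge_nonneg H (hub s) (2 * j + 1)]
  · have hisolated : ∀ {s i}, columnEdge H (hub s) (center s i) (2 * j + 1) = 1 →
        columnEdge H root (hub s) (2 * j + 1) ≤ 0 := by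
      intro s i h
      have hsum := Finset.single_le_sum
        (fun l _ ↦ columnEdge_nonneg H (hub s) (center s l) (2 * j + 1)) (Finset.mem_univ i)
      rw [h] at hsum
      rw [columnEdge_comm]
      linarith [hhub_degree s, rowEdge_nonneg H (hub s) (2 * j + 1)]
    have hroot_degree := hdegree root
    rw [neighborFinset_root, Finset.sum_pair (by simp), hroot] at hroot_degree
    have h1 := hisolated h
    have h2 := hisolated h'
    have h3 := rowEdge_le_one H root (2 * j + 1)
    cases s <;> cases s' <;> first | exact hs rfl | linarith

lemma not_isHamiltonian (hm : 1 ≤ m) (hmn : m ≤ 4 * n + 1) :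
    ¬ (tree n □ pathGraph m).IsHamiltonian := by
  intro hham
  have : Nonempty (Fin m) := ⟨⟨0, hm⟩⟩
  have : Nontrivial (BroomVertex n) := ⟨root, hub false, by simp⟩
  obtain ⟨H, hH, hconn, hdeg⟩ := hham.exists_connected_two_regular
  choose j hjm hj using fun p : Bool × Fin n ↦ exists_odd_columnEdge hH hdeg hconn hm p.1 p.2
  have hcard : (Finset.range (m / 2 - 1)).card < (Finset.univ : Finset (Bool × Fin n)).card := by
    have hmeven := even_length hH hdeg hm
    rcases hmeven with ⟨r, rfl⟩
    simp
    omega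
  obtain ⟨p, -, q, -, hpq, heq⟩ := Finset.exists_ne_map_eq_of_card_lt_of_maps_to hcard
    (f := j) (fun p _ ↦ by have := hjm p; simp; omega)
  exact not_columnEdge_of_ne hH hdeg (by have := hjm p; omega) hpq (hj p) (heq ▸ hj q)

end Hamiltonian

end BroomVertex

/-- For every `Δ ≥ 3` there is a tree `T` of maximum degree `Δ` having a path factor,
such that `T □ Pₘ` is not hamiltonian for every `m ≤ 4Δ − 3`. -/
theorem stmt8 (Δ : ℕ) (hΔ : 3 ≤ Δ) :
    ∃ (N : ℕ) (T : SimpleGraph (Fin N)),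
      T.IsTree ∧
      (∀ v, (T.neighborSet v).ncard ≤ Δ) ∧
      (∃ v, (T.neighborSet v).ncard = Δ) ∧
      (∃ F : Set (Σ u v : Fin N, T.Walk u v), T.IsPathCover F) ∧
      (∀ m : ℕ, 1 ≤ m → m ≤ 4 * Δ - 3 → ¬ (T □ pathGraph m).IsHamiltonian) := by
  obtain ⟨n, rfl⟩ : ∃ n, Δ = n + 1 := ⟨Δ - 1, by omega⟩
  let e := (BroomVertex.tree n).overFinIso rfl
  have hdegree : ∀ v, (((BroomVertex.tree n).overFin rfl).neighborSet (e v)).ncard =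
      (BroomVertex.tree n).degree v := fun v ↦ by
    rw [e.ncard_neighborSet_eq, Set.ncard_eq_toFinset_card', degree, neighborFinset]
  obtain ⟨F, hF⟩ := BroomVertex.exists_isPathCover n
  refine ⟨_, (BroomVertex.tree n).overFin rfl, e.isTree_iff.1 BroomVertex.tree_isTree,
    fun v ↦ ?_, ⟨e (.hub false), ?_⟩, hF.exists_of_iso e, fun m hm hmΔ hham ↦ ?_⟩
  · obtain ⟨v, rfl⟩ := e.surjective v
    exact (hdegree v).trans_le (BroomVertex.degree_le (by omega) v)
  · rw [hdegree, BroomVertex.degree_hub]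
  · exact BroomVertex.not_isHamiltonian hm (by omega)
      (hham.of_iso (e.boxProdCongrLeft (pathGraph m)).symm)
end
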